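/- Let m, n ≥ 1 and let P be a finite poset whose Hasse diagram, viewed as an undirected graph, is isomorphic to the complete bipartite graph K_{m,n}. Then P is isomorphic to a complete ranked poset Q_{i, m, n−i} for some 0 < i ≤ n, or to Q_{i, n, m−i} for some 0 < i ≤ m. In particular, P contains no chain of three distinct elements together with a fourth rank. -/

import Mathlib

/-- The Hasse diagram of a partial order `P`, viewed as an undirected simple graph:
`x` and `y` are adjacent iff one covers the other. -/
def hasseGraph (A : Type*) (P : PartialOrder A) : SimpleGraph A where
  Adj x y := @CovBy A P.toPreorder.toLT x y ∨ @CovBy A P.toPreorder.toLT y x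
  symm := ⟨fun x y h => h.symm⟩
  loopless := ⟨fun x h => by
    letI := P
    rcases h with h | h <;> exact absurd h.1 (lt_irrefl x)⟩

/-- Rank function for the three-ranked poset. -/
def rank3 {a b c : ℕ} : Fin a ⊕ Fin b ⊕ Fin c → ℕ
  | Sum.inl _ => 0
  | Sum.inr (Sum.inl _) => 1
  | Sum.inr (Sum.inr _) => 2

/-- The complete ranked poset `Q_{a,b,c}` with ranks of sizes `a`, `b`, `c` (from bottom to
top): distinct elements are comparable iff they lie in different ranks, ordered by rank. -/
def Q3 (a b c : ℕ) : PartialOrder (Fin a ⊕ Fin b ⊕ Fin c) where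
  le x y := x = y ∨ rank3 x < rank3 y
  lt x y := rank3 x < rank3 y
  lt_iff_le_not_ge x y := by
    constructor
    · intro h
      have h' : rank3 x < rank3 y := h
      refine ⟨Or.inr h', fun hc => ?_⟩
      rcases hc with rfl | h2
      · exact Nat.lt_irrefl _ h'
      · exact Nat.lt_irrefl _ (h'.trans h2)
    · rintro ⟨h1, h2⟩
      rcases h1 with rfl | h
      · exact absurd (Or.inl rfl) h2
      · exact h
  le_refl x := Or.inl rfl
  le_trans x y z hxy hyz := by
    rcases hxy with rfl | h1
    · exact hyz
    · rcases hyz with rfl | h2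
      · exact Or.inr h1
      · exact Or.inr (h1.trans h2)
  le_antisymm x y hxy hyx := by
    rcases hxy with rfl | h1
    · rfl
    · rcases hyx with rfl | h2
      · rfl
      · exact absurd (h1.trans h2) (lt_irrefl _)

section CompleteBipartiteHasse

theorem Bool.eq_of_ne_of_ne {p q r : Bool} (hq : p ≠ q) (hr : p ≠ r) : q = r := by
  revert p q r
  decide

variable {A : Type*} [PartialOrder A]

/-- A two-coloring whose bichromatic pairs are exactly the covering pairs; equivalently, the Hasse
diagram is complete bipartite with the color classes as parts. -/
def IsHasseColoring (c : A → Bool) : Prop :=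
  ∀ x y, (x ⋖ y ∨ y ⋖ x) ↔ c x ≠ c y

/-- The color class of `t` forms a middle layer: every other element lies entirely below it or
entirely above it, and some element lies below it. -/
def IsMiddleColor (c : A → Bool) (t : Bool) : Prop :=
  (∃ a, c a ≠ t ∧ ∀ b, c b = t → a < b) ∧
    ∀ x, c x ≠ t → (∀ b, c b = t → x < b) ∨ (∀ b, c b = t → b < x)

open Classical in
/-- The rank of an element relative to a middle layer: `0` below, `1` inside, `2` above. -/
noncomputable def middleRank (c : A → Bool) (t : Bool) (x : A) : ℕ :=
  if c x = t then 1 else if ∀ b, c b = t → x < b then 0 else 2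

theorem middleRank_le_two (c : A → Bool) (t : Bool) (x : A) : middleRank c t x ≤ 2 := by
  unfold middleRank
  split_ifs <;> omega

theorem middleRank_eq_one_iff (c : A → Bool) (t : Bool) (x : A) :
    middleRank c t x = 1 ↔ c x = t := by
  unfold middleRank
  split_ifs <;> simp_all

/-- A poset with a three-valued rank function that determines the order is a complete ranked
poset. -/
theorem nonempty_orderIso_Q3 {a b d : ℕ} (r : A → ℕ) (hr : ∀ x, r x ≤ 2)
    (hlt : ∀ x y, x < y ↔ r x < r y)
    (e₀ : Fin a ≃ {x // r x = 0}) (e₁ : Fin b ≃ {x // r x = 1}) (e₂ : Fin d ≃ {x // r x = 2}) :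
    Nonempty (@OrderIso A (Fin a ⊕ Fin b ⊕ Fin d) _ (Q3 a b d).toPreorder.toLE) := by
  let f : Fin a ⊕ Fin b ⊕ Fin d → A :=
    Sum.elim (fun i => (e₀ i : A)) (Sum.elim (fun i => (e₁ i : A)) (fun i => (e₂ i : A)))
  have hrf : ∀ s, r (f s) = rank3 s := by
    rintro (i | i | i)
    · exact (e₀ i).2
    · exact (e₁ i).2
    · exact (e₂ i).2
  have hinj : Function.Injective f := by
    intro s s' h
    have hrank : rank3 s = rank3 s' := by rw [← hrf, ← hrf, h]
    rcases s with i | i | i <;> rcases s' with j | j | j <;>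
      simp_all [f, rank3, Subtype.coe_inj]
  have hsurj : Function.Surjective f := by
    intro x
    have hx := hr x
    interval_cases h : r x
    · exact ⟨Sum.inl (e₀.symm ⟨x, h⟩), by simp [f]⟩
    · exact ⟨Sum.inr (Sum.inl (e₁.symm ⟨x, h⟩)), by simp [f]⟩
    · exact ⟨Sum.inr (Sum.inr (e₂.symm ⟨x, h⟩)), by simp [f]⟩
  refine ⟨@OrderIso.symm _ _ (Q3 a b d).toPreorder.toLE _
    (@RelIso.mk _ _ (Q3 a b d).le _ (Equiv.ofBijective f ⟨hinj, hsurj⟩) ?_)⟩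
  intro s s'
  change f s ≤ f s' ↔ s = s' ∨ rank3 s < rank3 s'
  rw [le_iff_eq_or_lt, hlt, hrf, hrf, hinj.eq_iff]

variable {c : A → Bool}

theorem IsHasseColoring.lt_or_lt {x y : A} (hc : IsHasseColoring c) (h : c x ≠ c y) :
    x < y ∨ y < x :=
  ((hc x y).2 h).imp CovBy.lt CovBy.lt

variable [Finite A]

theorem exists_covBy_le_of_lt_finite {x y : A} (h : x < y) : ∃ z, x ⋖ z ∧ z ≤ y := by
  have := Fintype.ofFinite A
  let : LocallyFiniteOrder A := by
    classical
    exact Fintype.toLocallyFiniteOrder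
  exact exists_covBy_le_of_lt h

theorem IsHasseColoring.not_four_chain (hc : IsHasseColoring c) {x y z w : A}
    (hxy : x < y) (hyz : y < z) (hzw : z < w) : False := by
  obtain ⟨p, hxp, hpy⟩ := exists_covBy_le_of_lt_finite hxy
  obtain ⟨q, hpq, hqz⟩ := exists_covBy_le_of_lt_finite (hpy.trans_lt hyz)
  obtain ⟨s, hqs, -⟩ := exists_covBy_le_of_lt_finite (hqz.trans_lt hzw)
  have h₁ := (hc x p).1 (Or.inl hxp)
  have h₂ := (hc p q).1 (Or.inl hpq)
  have h₃ := (hc q s).1 (Or.inl hqs)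
  have h₄ : c x ≠ c s := Bool.eq_of_ne_of_ne h₁.symm h₂ ▸ h₃
  rcases (hc x s).2 h₄ with h | h
  · exact h.2 hxp.lt (hpq.lt.trans hqs.lt)
  · exact lt_asymm h.lt (hxp.lt.trans (hpq.lt.trans hqs.lt))

theorem IsHasseColoring.exists_isMiddleColor (hc : IsHasseColoring c) {u v : A}
    (huv : c u ≠ c v) : ∃ t, IsMiddleColor c t := by
  by_cases h3 : ∃ x y z : A, x < y ∧ y < z
  · obtain ⟨x, y, z, hxy, hyz⟩ := h3
    obtain ⟨p, hxp, hpy⟩ := exists_covBy_le_of_lt_finite hxy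
    obtain ⟨q, hpq, -⟩ := exists_covBy_le_of_lt_finite (hpy.trans_lt hyz)
    have h₁ := (hc x p).1 (Or.inl hxp)
    have hx : ∀ b, c b = c p → x < b := fun b hb =>
      (hc.lt_or_lt (hb ▸ h₁)).resolve_right fun h => hc.not_four_chain h hxp.lt hpq.lt
    refine ⟨c p, ⟨x, h₁, hx⟩, fun a ha => ?_⟩
    by_contra! hcon
    obtain ⟨⟨b₁, hb₁, h₁a⟩, b₂, hb₂, h₂a⟩ := hcon
    have hb₁a := (hc.lt_or_lt (hb₁ ▸ ha)).resolve_left h₁a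
    have hab₂ := (hc.lt_or_lt (hb₂ ▸ ha)).resolve_right h₂a
    have hb₂q : b₂ < q := by
      have h₂ := (hc p q).1 (Or.inl hpq)
      exact (hc.lt_or_lt (hb₂ ▸ h₂)).resolve_right fun h => hc.not_four_chain hxp.lt hpq.lt h
    exact hc.not_four_chain hb₁a hab₂ hb₂q
  · push Not at h3
    wlog h : u < v generalizing u v
    · exact this huv.symm ((hc.lt_or_lt huv).resolve_left h)
    have hbelow : ∀ a, c a ≠ c v → ∀ b, c b = c v → a < b := by
      intro a ha b hb
      have hub : u < b := (hc.lt_or_lt (hb ▸ huv)).resolve_right fun h' => h3 _ _ _ h' h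
      exact (hc.lt_or_lt (hb ▸ ha)).resolve_right fun h' => h3 _ _ _ hub h'
    exact ⟨c v, ⟨u, huv, hbelow u huv⟩, fun a ha => Or.inl (hbelow a ha)⟩

theorem IsHasseColoring.lt_iff_middleRank_lt (hc : IsHasseColoring c) {t : Bool}
    (ht : IsMiddleColor c t) {b₀ : A} (hb₀ : c b₀ = t) (x y : A) :
    x < y ↔ middleRank c t x < middleRank c t y := by
  have key : ∀ z, (c z = t ∧ middleRank c t z = 1) ∨
      (c z ≠ t ∧ middleRank c t z = 0 ∧ ∀ b, c b = t → z < b) ∨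
      (c z ≠ t ∧ middleRank c t z = 2 ∧ ∀ b, c b = t → b < z) := by
    intro z
    unfold middleRank
    split_ifs with h₁ h₂
    · exact Or.inl ⟨h₁, rfl⟩
    · exact Or.inr (Or.inl ⟨h₁, rfl, h₂⟩)
    · exact Or.inr (Or.inr ⟨h₁, rfl, (ht.2 z h₁).resolve_left h₂⟩)
  have hmono : ∀ x y, middleRank c t x < middleRank c t y → x < y := by
    intro x y h
    rcases key x with ⟨hx, hrx⟩ | ⟨hx, hrx, hbx⟩ | ⟨hx, hrx, hbx⟩ <;>
    rcases key y with ⟨hy, hry⟩ | ⟨hy, hry, hby⟩ | ⟨hy, hry, hby⟩ <;>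
    first
    | omega
    | exact hbx _ hy
    | exact hby _ hx
    | exact (hbx _ hb₀).trans (hby _ hb₀)
  refine ⟨fun h => ?_, hmono x y⟩
  rcases lt_trichotomy (middleRank c t x) (middleRank c t y) with h' | h' | h'
  · exact h'
  · exfalso
    obtain ⟨z, hxz, hzy⟩ := exists_covBy_le_of_lt_finite h
    have hcz := (hc x z).1 (Or.inl hxz)
    rcases key x with ⟨hx, hrx⟩ | ⟨hx, hrx, hbx⟩ | ⟨hx, hrx, hbx⟩ <;>
    rcases key y with ⟨hy, hry⟩ | ⟨hy, hry, hby⟩ | ⟨hy, hry, hby⟩ <;>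
    try omega
    · rcases key z with ⟨hz, -⟩ | ⟨-, -, hbz⟩ | ⟨-, -, hbz⟩
      · exact hcz (hx.trans hz.symm)
      · exact lt_asymm hxz.lt (hbz x hx)
      · exact (hbz y hy).not_ge hzy
    · exact (hby z (Bool.eq_of_ne_of_ne hcz hx)).not_ge hzy
    · exact lt_asymm hxz.lt (hbx z (Bool.eq_of_ne_of_ne hcz hx))
  · exact absurd (hmono y x h') (lt_asymm h)

theorem IsHasseColoring.exists_orderIso_Q3 (hc : IsHasseColoring c) {t : Bool}
    (ht : IsMiddleColor c t) {k l : ℕ} (hk : 1 ≤ k)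
    (hcard : Nat.card {x // c x = t} = k) (hcard' : Nat.card {x // c x ≠ t} = l) :
    ∃ i : ℕ, 0 < i ∧ i ≤ l ∧
      Nonempty (@OrderIso A (Fin i ⊕ Fin k ⊕ Fin (l - i)) _ (Q3 i k (l - i)).toPreorder.toLE) := by
  obtain ⟨b₀, hb₀⟩ : Nonempty {x // c x = t} := (Nat.card_pos_iff.1 (by omega)).1
  have hlt := hc.lt_iff_middleRank_lt ht hb₀
  have h₁ : Nat.card {x // middleRank c t x = 1} = k := by
    simpa only [middleRank_eq_one_iff] using hcard
  have hsum : Nat.card {x // middleRank c t x = 0} + Nat.card {x // middleRank c t x = 2} = l := by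
    classical
    rw [← Nat.card_sum, ← hcard']
    refine Nat.card_congr ((Equiv.subtypeEquivRight fun x => ?_).trans
      (subtypeOrEquiv _ _ ?_)).symm
    · have h₂ := middleRank_le_two c t x
      rw [Ne, ← middleRank_eq_one_iff]
      omega
    · rw [Pi.disjoint_iff]
      intro x
      simp only [Prop.disjoint_iff]
      omega
  obtain ⟨a, ha, hab⟩ := ht.1
  have hra : middleRank c t a = 0 := by
    rw [middleRank, if_neg ha, if_pos hab]
  have hpos : 0 < Nat.card {x // middleRank c t x = 0} :=
    Nat.card_pos_iff.2 ⟨⟨a, hra⟩, inferInstance⟩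
  refine ⟨_, hpos, by omega, nonempty_orderIso_Q3 _ (middleRank_le_two c t) hlt
    (Finite.equivFin _).symm (Finite.equivFinOfCardEq h₁).symm
    (Finite.equivFinOfCardEq (by omega)).symm⟩

end CompleteBipartiteHasse

/-- If the Hasse diagram of a finite poset `P`, viewed as an undirected
graph, is isomorphic to the complete bipartite graph `K_{m,n}` (`m, n ≥ 1`), then `P` is
isomorphic to a complete ranked poset `Q_{i,m,n−i}` for some `0 < i ≤ n` or `Q_{i,n,m−i}` for
some `0 < i ≤ m`; in particular `P` has no chain of four elements. -/
theorem stmt9 (m n : ℕ) (hm : 1 ≤ m) (hn : 1 ≤ n) (A : Type*) [Fintype A]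
    (P : PartialOrder A)
    (hiso : Nonempty (hasseGraph A P ≃g completeBipartiteGraph (Fin m) (Fin n))) :
    ((∃ i : ℕ, 0 < i ∧ i ≤ n ∧
        Nonempty (@OrderIso A (Fin i ⊕ Fin m ⊕ Fin (n - i))
          P.toPreorder.toLE (Q3 i m (n - i)).toPreorder.toLE)) ∨
      (∃ i : ℕ, 0 < i ∧ i ≤ m ∧
        Nonempty (@OrderIso A (Fin i ⊕ Fin n ⊕ Fin (m - i))
          P.toPreorder.toLE (Q3 i n (m - i)).toPreorder.toLE))) ∧
    ¬ ∃ x y z w : A, P.lt x y ∧ P.lt y z ∧ P.lt z w := by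
  obtain ⟨e⟩ := hiso
  let := P
  let c : A → Bool := fun x => (e x).isLeft
  have hc : IsHasseColoring c := by
    intro x y
    have h : (x ⋖ y ∨ y ⋖ x) ↔ (completeBipartiteGraph (Fin m) (Fin n)).Adj (e x) (e y) :=
      e.map_adj_iff.symm
    rw [h]
    rcases hx : e x <;> rcases hy : e y <;> simp [c, hx, hy]
  have hleft : Nat.card {x // c x = true} = m :=
    (Nat.card_congr ((e.toEquiv.subtypeEquiv fun x => by
      change (e x).isLeft = true ↔ e x ∈ Set.range Sum.inl
      cases e x <;> simp).trans (Equiv.Set.rangeInl (Fin m) (Fin n)))).trans (Nat.card_fin m)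
  have hright : Nat.card {x // c x = false} = n :=
    (Nat.card_congr ((e.toEquiv.subtypeEquiv fun x => by
      change (e x).isLeft = false ↔ e x ∈ Set.range Sum.inr
      cases e x <;> simp).trans (Equiv.Set.rangeInr (Fin m) (Fin n)))).trans (Nat.card_fin n)
  refine ⟨?_, fun ⟨x, y, z, w, hxy, hyz, hzw⟩ => hc.not_four_chain hxy hyz hzw⟩
  have huv : c (e.symm (Sum.inl ⟨0, hm⟩)) ≠ c (e.symm (Sum.inr ⟨0, hn⟩)) := by simp [c]
  obtain ⟨t, ht⟩ := hc.exists_isMiddleColor huv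
  cases t
  · exact Or.inr (hc.exists_orderIso_Q3 ht hn hright (by simpa using hleft))
  · exact Or.inl (hc.exists_orderIso_Q3 ht hm hleft (by simpa using hright))
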